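/- Let f : ℝ^d → ℝ be twice continuously differentiable, μ-strongly convex, and 3rd order smooth with constant M₃ (that is, |vᵀ(D²f(x) − D²f(y))v| ≤ M₃³ ‖x−y‖₂ for all x, y and all unit vectors v). Let k : [−1,1] → ℝ be a bounded measurable kernel with E_r[r k(r)] = 1 (r uniform on [−1,1]), and let δ > 0 satisfy δ · M₃³ · E_r[r² |k(r)|] ≤ μ/2. Then the smoothed function f̂_δ is (μ/2)-strongly convex on ℝ^d. -/

import Mathlib

open MeasureTheory Metric

/-- The uniform probability distribution on the interval `[-1, 1] ⊆ ℝ`. -/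
noncomputable def intervalUniform : Measure ℝ :=
  (2 : ENNReal)⁻¹ • (volume.restrict (Set.Icc (-1 : ℝ) 1))

/-- The uniform probability distribution on the closed Euclidean unit ball of `ℝ^d`. -/
noncomputable def ballUniform (d : ℕ) : Measure (EuclideanSpace ℝ (Fin d)) :=
  (volume (closedBall (0 : EuclideanSpace ℝ (Fin d)) 1))⁻¹ •
    (volume.restrict (closedBall (0 : EuclideanSpace ℝ (Fin d)) 1))

/-- The smoothed version `f̂_δ` of `f : ℝ^d → ℝ`:
`f̂_δ(x) = E[f(x + r δ v) r k(r)]` where `r` is uniform on `[-1,1]` and `v` is independent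
of `r`, uniform on the closed unit ball. -/
noncomputable def smoothed (d : ℕ) (f : EuclideanSpace ℝ (Fin d) → ℝ) (δ : ℝ) (k : ℝ → ℝ)
    (x : EuclideanSpace ℝ (Fin d)) : ℝ :=
  ∫ p : ℝ × EuclideanSpace ℝ (Fin d), f (x + (p.1 * δ) • p.2) * (p.1 * k p.1)
    ∂(intervalUniform.prod (ballUniform d))

lemma line_hasDerivAt {E : Type*} [NormedAddCommGroup E] [NormedSpace ℝ E] (x u : E) (t : ℝ) :
    HasDerivAt (fun t : ℝ => x + t • u) u t := by
  simpa using ((hasDerivAt_id t).smul_const u).const_add x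

lemma line_deriv1 {E : Type*} [NormedAddCommGroup E] [NormedSpace ℝ E] (f : E → ℝ)
    (hf : ContDiff ℝ 2 f) (x u : E) (t : ℝ) :
    HasDerivAt (fun t : ℝ => f (x + t • u)) (fderiv ℝ f (x + t • u) u) t :=
  ((hf.differentiable (by norm_num)) (x + t • u)).hasFDerivAt.comp_hasDerivAt t
    (line_hasDerivAt x u t)

lemma line_deriv2 {E : Type*} [NormedAddCommGroup E] [NormedSpace ℝ E] (f : E → ℝ)
    (hf : ContDiff ℝ 2 f) (x u : E) (t : ℝ) :
    HasDerivAt (fun t : ℝ => fderiv ℝ f (x + t • u) u)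
      (iteratedFDeriv ℝ 2 f (x + t • u) (fun _ => u)) t := by
  have h1 : ContDiff ℝ 1 (fderiv ℝ f) := hf.fderiv_right (by norm_num)
  have h2 := ((h1.differentiable (by norm_num)) (x + t • u)).hasFDerivAt.comp_hasDerivAt t
    (line_hasDerivAt x u t)
  have h3 := h2.clm_apply (hasDerivAt_const t u)
  rw [iteratedFDeriv_two_apply]
  simpa using h3

lemma smooth3_general {E : Type*} [NormedAddCommGroup E] [NormedSpace ℝ E] (f : E → ℝ) (M : ℝ)
    (h3 : ∀ (x y v : E), ‖v‖ = 1 →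
      |iteratedFDeriv ℝ 2 f x (fun _ => v) - iteratedFDeriv ℝ 2 f y (fun _ => v)| ≤ M * ‖x - y‖)
    (x y u : E) :
    |iteratedFDeriv ℝ 2 f x (fun _ => u) - iteratedFDeriv ℝ 2 f y (fun _ => u)|
      ≤ M * ‖x - y‖ * ‖u‖ ^ 2 := by
  by_cases hu : u = 0
  · subst hu
    simp [iteratedFDeriv_two_apply]
  have hu' : ‖u‖ ≠ 0 := norm_ne_zero_iff.mpr hu
  have hv : ‖(‖u‖⁻¹ • u)‖ = 1 := by
    rw [norm_smul, norm_inv, norm_norm, inv_mul_cancel₀ hu']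
  have h := h3 x y _ hv
  have key : ∀ z, iteratedFDeriv ℝ 2 f z (fun _ => u)
      = ‖u‖ ^ 2 * iteratedFDeriv ℝ 2 f z (fun _ => ‖u‖⁻¹ • u) := by
    intro z
    simp only [iteratedFDeriv_two_apply, map_smul, smul_apply, smul_eq_mul]
    field_simp
  rw [key x, key y, ← mul_sub, abs_mul, abs_of_nonneg (sq_nonneg ‖u‖), mul_comm]
  gcongr

lemma gap_one {E : Type*} [NormedAddCommGroup E] [NormedSpace ℝ E] (f : E → ℝ)
    (hf : ContDiff ℝ 2 f) (M : ℝ)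
    (h3 : ∀ (x y v : E), ‖v‖ = 1 →
      |iteratedFDeriv ℝ 2 f x (fun _ => v) - iteratedFDeriv ℝ 2 f y (fun _ => v)| ≤ M * ‖x - y‖)
    (x y h : E) (a b : ℝ) (ha : 0 ≤ a) (hb : 0 ≤ b) (hab : a + b = 1) (s : ℝ) (hs : |s| = 1) :
    - (M * ‖h‖ / 2 * (a * b * ‖y - x‖ ^ 2)) ≤
      s * ((a * f (x + h) + b * f (y + h) - f (a • x + b • y + h))
        - (a * f x + b * f y - f (a • x + b • y))) := by
  set u := y - x with hu
  set L := M * ‖h‖ * ‖u‖ ^ 2 with hL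
  let q : ℝ → ℝ := fun t => s * (f ((x + h) + t • u) - f (x + t • u)) + L / 2 * t ^ 2
  let q' : ℝ → ℝ := fun t =>
    s * (fderiv ℝ f ((x + h) + t • u) u - fderiv ℝ f (x + t • u) u) + L * t
  let q'' : ℝ → ℝ := fun t => s * (iteratedFDeriv ℝ 2 f ((x + h) + t • u) (fun _ => u)
    - iteratedFDeriv ℝ 2 f (x + t • u) (fun _ => u)) + L
  have hq : ∀ t, HasDerivAt q (q' t) t := by
    intro t
    have h1 := (((line_deriv1 f hf (x + h) u t).sub (line_deriv1 f hf x u t)).const_mul s).add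
      (((hasDerivAt_id t).pow 2).const_mul (L / 2))
    refine h1.congr_deriv ?_
    simp only [q', id, Nat.cast_ofNat]
    ring
  have hq' : ∀ t, HasDerivAt q' (q'' t) t := by
    intro t
    have h1 := (((line_deriv2 f hf (x + h) u t).sub (line_deriv2 f hf x u t)).const_mul s).add
      ((hasDerivAt_id t).const_mul L)
    refine h1.congr_deriv ?_
    simp only [q'']
    ring
  have e1 : deriv q = q' := funext fun t => (hq t).deriv
  have e2 : deriv q' = q'' := funext fun t => (hq' t).deriv
  have hconv : ConvexOn ℝ Set.univ q := by
    apply convexOn_univ_of_deriv2_nonneg (fun t => (hq t).differentiableAt)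
    · rw [e1]; exact fun t => (hq' t).differentiableAt
    · intro t
      simp only [Function.iterate_succ, Function.iterate_zero, Function.comp, id, e1, e2]
      have h4 := smooth3_general f M h3 ((x + h) + t • u) (x + t • u) u
      have h5 : (x + h) + t • u - (x + t • u) = h := by abel
      rw [h5, ← hL] at h4
      simp only [q'']
      set A := iteratedFDeriv ℝ 2 f ((x + h) + t • u) (fun _ => u)
        - iteratedFDeriv ℝ 2 f (x + t • u) (fun _ => u)
      have h6 : |s * A| ≤ L := by rw [abs_mul, hs, one_mul]; exact h4
      linarith [neg_abs_le (s * A)]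
  have h7 := hconv.2 (Set.mem_univ (0 : ℝ)) (Set.mem_univ (1 : ℝ)) ha hb hab
  have ea : a = 1 - b := by linarith
  have p1 : x + h + b • u = a • x + b • y + h := by rw [hu, ea]; module
  have p2 : x + b • u = a • x + b • y := by rw [hu, ea]; module
  have p3 : x + h + u = y + h := by rw [hu]; abel
  have p4 : x + u = y := by rw [hu]; abel
  simp only [q, smul_eq_mul, mul_zero, mul_one, zero_add, zero_smul, add_zero, one_smul,
    p1, p2, p3, p4] at h7
  have e : M * ‖h‖ / 2 * (a * b * ‖u‖ ^ 2) = L / 2 * (b - b ^ 2) := by rw [hL, ea]; ring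
  rw [e]
  nlinarith [h7]

lemma gap_bound {E : Type*} [NormedAddCommGroup E] [NormedSpace ℝ E] (f : E → ℝ)
    (hf : ContDiff ℝ 2 f) (M : ℝ)
    (h3 : ∀ (x y v : E), ‖v‖ = 1 →
      |iteratedFDeriv ℝ 2 f x (fun _ => v) - iteratedFDeriv ℝ 2 f y (fun _ => v)| ≤ M * ‖x - y‖)
    (x y h : E) (a b : ℝ) (ha : 0 ≤ a) (hb : 0 ≤ b) (hab : a + b = 1) :
    |(a * f (x + h) + b * f (y + h) - f (a • x + b • y + h))
        - (a * f x + b * f y - f (a • x + b • y))| ≤ M * ‖h‖ / 2 * (a * b * ‖y - x‖ ^ 2) := by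
  have h1 := gap_one f hf M h3 x y h a b ha hb hab 1 (by simp)
  have h2 := gap_one f hf M h3 x y h a b ha hb hab (-1) (by simp)
  rw [abs_le]
  constructor <;> linarith

lemma norm_gap {E : Type*} [NormedAddCommGroup E] [InnerProductSpace ℝ E] (x y : E) (a b : ℝ)
    (hab : a + b = 1) :
    a * ‖x‖ ^ 2 + b * ‖y‖ ^ 2 - ‖a • x + b • y‖ ^ 2 = a * b * ‖y - x‖ ^ 2 := by
  have ea : a = 1 - b := by linarith
  rw [norm_add_sq_real, norm_sub_sq_real, norm_smul, norm_smul, inner_smul_left, inner_smul_right,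
    mul_pow, mul_pow, Real.norm_eq_abs, Real.norm_eq_abs, sq_abs, sq_abs, real_inner_comm x y, ea]
  simp
  ring

instance intervalUniform_prob : IsProbabilityMeasure intervalUniform := by
  constructor
  simp only [intervalUniform, Measure.smul_apply, Measure.restrict_apply_univ, Real.volume_Icc,
    smul_eq_mul]
  norm_num
  exact ENNReal.inv_mul_cancel (by simp) (by simp)

instance ballUniform_prob (d : ℕ) : IsProbabilityMeasure (ballUniform d) := by
  constructor
  simp only [ballUniform, Measure.smul_apply, Measure.restrict_apply_univ, smul_eq_mul]
  exact ENNReal.inv_mul_cancel (measure_closedBall_pos _ _ one_pos).ne'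
    measure_closedBall_lt_top.ne

lemma ae_interval : ∀ᵐ r ∂intervalUniform, r ∈ Set.Icc (-1 : ℝ) 1 :=
  Measure.ae_smul_measure (ae_restrict_mem measurableSet_Icc) _

lemma ae_ball (d : ℕ) : ∀ᵐ v ∂(ballUniform d), v ∈ closedBall (0 : EuclideanSpace ℝ (Fin d)) 1 :=
  Measure.ae_smul_measure (ae_restrict_mem measurableSet_closedBall) _

lemma ae_both (d : ℕ) : ∀ᵐ p ∂(intervalUniform.prod (ballUniform d)),
    p.1 ∈ Set.Icc (-1 : ℝ) 1 ∧ p.2 ∈ closedBall (0 : EuclideanSpace ℝ (Fin d)) 1 := by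
  filter_upwards [Measure.quasiMeasurePreserving_fst.ae ae_interval,
    Measure.quasiMeasurePreserving_snd.ae (ae_ball d)] with p h1 h2 using ⟨h1, h2⟩

lemma integrable_aux (d : ℕ) (g : ℝ × EuclideanSpace ℝ (Fin d) → ℝ) (hg : Continuous g)
    (k : ℝ → ℝ) (hkmeas : Measurable k) (hkbdd : ∃ C, ∀ r ∈ Set.Icc (-1 : ℝ) 1, |k r| ≤ C) :
    Integrable (fun p => g p * k p.1) (intervalUniform.prod (ballUniform d)) := by
  obtain ⟨C, hC⟩ := hkbdd
  obtain ⟨B, hB⟩ := ((isCompact_Icc (a := (-1 : ℝ)) (b := 1)).prod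
    (isCompact_closedBall (0 : EuclideanSpace ℝ (Fin d)) 1)).exists_bound_of_continuousOn
      hg.continuousOn
  refine Integrable.of_bound (C := B * C) ?_ ?_
  · exact (hg.measurable.mul (hkmeas.comp measurable_fst)).aestronglyMeasurable
  · filter_upwards [ae_both d] with p hp
    have h1 := hB p ⟨hp.1, hp.2⟩
    rw [norm_mul]
    exact mul_le_mul h1 (hC _ hp.1) (norm_nonneg _) ((norm_nonneg _).trans h1)

theorem stmt_9 (d : ℕ) (hd : 1 ≤ d) (μ : ℝ) (hμ : 0 < μ)
    (f : EuclideanSpace ℝ (Fin d) → ℝ) (hf : ContDiff ℝ 2 f)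
    (hstrong : ConvexOn ℝ Set.univ (fun x => f x - μ / 2 * ‖x‖ ^ 2))
    (M₃ : ℝ) (hM₃ : 0 < M₃)
    (hsmooth3 : ∀ (x y v : EuclideanSpace ℝ (Fin d)), ‖v‖ = 1 →
      |iteratedFDeriv ℝ 2 f x (fun _ => v) - iteratedFDeriv ℝ 2 f y (fun _ => v)|
        ≤ M₃ ^ 3 * ‖x - y‖)
    (k : ℝ → ℝ) (hkmeas : Measurable k) (hkbdd : ∃ C, ∀ r ∈ Set.Icc (-1 : ℝ) 1, |k r| ≤ C)
    (hk1 : ∫ r, r * k r ∂intervalUniform = 1)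
    (δ : ℝ) (hδ : 0 < δ)
    (hδsmall : δ * M₃ ^ 3 * ∫ r, r ^ 2 * |k r| ∂intervalUniform ≤ μ / 2) :
    ConvexOn ℝ Set.univ (fun x => smoothed d f δ k x - (μ / 2) / 2 * ‖x‖ ^ 2) := by
  refine ⟨convex_univ, ?_⟩
  intro x _ y _ a b ha hb hab
  have hfc : Continuous f := hf.continuous
  have hint : ∀ z, Integrable (fun p : ℝ × EuclideanSpace ℝ (Fin d) =>
      f (z + (p.1 * δ) • p.2) * (p.1 * k p.1)) (intervalUniform.prod (ballUniform d)) := by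
    intro z
    have := integrable_aux d (fun p => f (z + (p.1 * δ) • p.2) * p.1) (by fun_prop) k hkmeas hkbdd
    simpa only [mul_assoc] using this
  have hint1 : Integrable (fun p : ℝ × EuclideanSpace ℝ (Fin d) => p.1 * k p.1)
      (intervalUniform.prod (ballUniform d)) :=
    integrable_aux d (fun p => p.1) (by fun_prop) k hkmeas hkbdd
  have hint2 : Integrable (fun p : ℝ × EuclideanSpace ℝ (Fin d) => p.1 ^ 2 * |k p.1|)
      (intervalUniform.prod (ballUniform d)) :=
    integrable_aux d (fun p => p.1 ^ 2) (by fun_prop) (fun r => |k r|) hkmeas.abs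
      (by simpa using hkbdd)
  have i1 : ∫ p : ℝ × EuclideanSpace ℝ (Fin d), p.1 * k p.1
      ∂(intervalUniform.prod (ballUniform d)) = 1 := by
    rw [integral_fun_fst (fun r => r * k r), hk1]; simp
  have i2 : ∫ p : ℝ × EuclideanSpace ℝ (Fin d), p.1 ^ 2 * |k p.1|
      ∂(intervalUniform.prod (ballUniform d)) = ∫ r, r ^ 2 * |k r| ∂intervalUniform := by
    rw [integral_fun_fst (fun r => r ^ 2 * |k r|)]; simp
  set K := ∫ r, r ^ 2 * |k r| ∂intervalUniform with hK
  set N := a * b * ‖y - x‖ ^ 2 with hN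
  have hN0 : 0 ≤ N := by positivity
  set G := a * f x + b * f y - f (a • x + b • y) with hG
  have hGlow : μ / 2 * N ≤ G := by
    have h := hstrong.2 (Set.mem_univ x) (Set.mem_univ y) ha hb hab
    simp only [smul_eq_mul] at h
    rw [hN, hG, ← norm_gap x y a b hab]
    linarith
  have hpt : ∀ᵐ p ∂(intervalUniform.prod (ballUniform d)),
      G * (p.1 * k p.1) - (M₃ ^ 3 * δ / 2 * N) * (p.1 ^ 2 * |k p.1|) ≤
      a * (f (x + (p.1 * δ) • p.2) * (p.1 * k p.1)) + b * (f (y + (p.1 * δ) • p.2) * (p.1 * k p.1))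
        - f (a • x + b • y + (p.1 * δ) • p.2) * (p.1 * k p.1) := by
    filter_upwards [ae_both d] with p hp
    have h1 := gap_bound f hf (M₃ ^ 3) hsmooth3 x y ((p.1 * δ) • p.2) a b ha hb hab
    rw [← hG, ← hN] at h1
    have hv : ‖p.2‖ ≤ 1 := by simpa using hp.2
    have h2 : ‖(p.1 * δ) • p.2‖ ≤ |p.1| * δ := by
      rw [norm_smul, norm_mul, Real.norm_eq_abs, Real.norm_eq_abs, abs_of_pos hδ]
      exact mul_le_of_le_one_right (by positivity) hv
    have h3 : M₃ ^ 3 * ‖(p.1 * δ) • p.2‖ / 2 * N ≤ M₃ ^ 3 * (|p.1| * δ) / 2 * N := by gcongr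
    have h4 := h1.trans h3
    set A := a * f (x + (p.1 * δ) • p.2) + b * f (y + (p.1 * δ) • p.2)
      - f (a • x + b • y + (p.1 * δ) • p.2) with hA
    have h5 : |(A - G) * (p.1 * k p.1)| ≤ (M₃ ^ 3 * δ / 2 * N) * (p.1 ^ 2 * |k p.1|) := by
      rw [abs_mul, abs_mul, ← sq_abs p.1]
      calc |A - G| * (|p.1| * |k p.1|)
          ≤ (M₃ ^ 3 * (|p.1| * δ) / 2 * N) * (|p.1| * |k p.1|) := by gcongr
        _ = _ := by ring
    have h6 := neg_abs_le ((A - G) * (p.1 * k p.1))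
    have h7 : a * (f (x + (p.1 * δ) • p.2) * (p.1 * k p.1))
        + b * (f (y + (p.1 * δ) • p.2) * (p.1 * k p.1))
        - f (a • x + b • y + (p.1 * δ) • p.2) * (p.1 * k p.1)
        = (A - G) * (p.1 * k p.1) + G * (p.1 * k p.1) := by rw [hA]; ring
    rw [h7]
    linarith
  have hadd : Integrable (fun p : ℝ × EuclideanSpace ℝ (Fin d) =>
      a * (f (x + (p.1 * δ) • p.2) * (p.1 * k p.1)) + b * (f (y + (p.1 * δ) • p.2) * (p.1 * k p.1)))
      (intervalUniform.prod (ballUniform d)) := ((hint x).const_mul a).add ((hint y).const_mul b)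
  have hmono := integral_mono_ae ((hint1.const_mul G).sub (hint2.const_mul (M₃ ^ 3 * δ / 2 * N)))
    (hadd.sub (hint (a • x + b • y))) hpt
  simp only [Pi.sub_apply, Pi.add_apply] at hmono
  rw [integral_sub (hint1.const_mul G) (hint2.const_mul (M₃ ^ 3 * δ / 2 * N)),
    integral_sub hadd (hint (a • x + b • y)),
    integral_add ((hint x).const_mul a) ((hint y).const_mul b)] at hmono
  simp only [integral_const_mul, i1, i2] at hmono
  have hsx : ∀ z, ∫ p : ℝ × EuclideanSpace ℝ (Fin d), f (z + (p.1 * δ) • p.2) * (p.1 * k p.1)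
    ∂(intervalUniform.prod (ballUniform d)) = smoothed d f δ k z := fun z => rfl
  simp only [hsx] at hmono
  have hn := norm_gap x y a b hab
  rw [← hN] at hn
  have h8 : (δ * M₃ ^ 3 * K) * N ≤ μ / 2 * N := mul_le_mul_of_nonneg_right hδsmall hN0
  simp only [smul_eq_mul]
  have h9 : μ / 2 / 2 * (a * ‖x‖ ^ 2 + b * ‖y‖ ^ 2 - ‖a • x + b • y‖ ^ 2) = μ / 2 / 2 * N := by
    rw [hn]
  nlinarith [hmono, h8, h9, hGlow]
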